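/- Let H be a finite graph with e(H) ≥ 1 and let η ∈ (η_H, 1). There exist C > 0 and ε_0 > 0 (depending only on η and H) such that for all ε ∈ (0, ε_0), all n ≥ v(H), and all q ∈ [0,1]^{E(K_n)} with E[N_H(q)] ≤ η·N_H(K_n): the constant vector with all entries η^{1/e(H)} is the unique minimizer of Φ(H,η), and if Σ_{e∈E(K_n)} h(q_e) < Φ(H,η) + ε^{12}·binom(n,2), then ‖q − η^{1/e(H)}‖_□ < C·ε. -/

import Mathlib

open scoped BigOperators

attribute [local instance] Classical.propDecidable

noncomputable section

namespace LowerTails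

/-- The edge set of the complete graph `K_n`: unordered pairs of distinct elements of `Fin n`. -/
abbrev Edge (n : ℕ) := {e : Sym2 (Fin n) // ¬ e.IsDiag}

/-- A graph on `[n]`, identified with its edge-indicator vector in `{0,1}^{E(K_n)}`. -/
abbrev EGraph (n : ℕ) := Edge n → Bool

/-- The probability of the configuration `G` under the product measure where edge `e`
is present independently with probability `q e`. -/
def wt {n : ℕ} (q : Edge n → ℝ) (G : EGraph n) : ℝ :=
  ∏ e : Edge n, if G e then q e else 1 - q e

/-- Probability of the event `S` under `G(n, q)`. -/
def pr {n : ℕ} (q : Edge n → ℝ) (S : Set (EGraph n)) : ℝ :=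
  ∑ G : EGraph n, if G ∈ S then wt q G else 0

/-- Conditional probability of `S` given `L` under `G(n, q)`. -/
def cpr {n : ℕ} (q : Edge n → ℝ) (L S : Set (EGraph n)) : ℝ :=
  pr q (S ∩ L) / pr q L

/-- Conditional expectation of `f` given the event `L` under `G(n, q)`. -/
def cex {n : ℕ} (q : Edge n → ℝ) (L : Set (EGraph n)) (f : EGraph n → ℝ) : ℝ :=
  (∑ G : EGraph n, if G ∈ L then wt q G * f G else 0) / pr q L

/-- The simple graph on `Fin n` associated to an edge-indicator vector. -/
def toSG {n : ℕ} (G : EGraph n) : SimpleGraph (Fin n) :=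
  SimpleGraph.fromEdgeSet {e : Sym2 (Fin n) | ∃ h : ¬e.IsDiag, G ⟨e, h⟩ = true}

/-- The number of copies of `H` in `G`, i.e. the number of subgraphs of `G` isomorphic to `H`. -/
def countCopies {k n : ℕ} (H : SimpleGraph (Fin k)) (G : SimpleGraph (Fin n)) : ℕ :=
  Set.ncard {K : G.Subgraph | Nonempty (H ≃g K.coe)}

/-- `N_H(G)` for an edge-indicator vector `G`, as a real number. -/
def NH {k n : ℕ} (H : SimpleGraph (Fin k)) (G : EGraph n) : ℝ :=
  countCopies H (toSG G)

/-- `E[N_H(q)]`, the expected number of copies of `H` in `G(n, q)`. -/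
def expNH {k : ℕ} (H : SimpleGraph (Fin k)) {n : ℕ} (q : Edge n → ℝ) : ℝ :=
  ∑ G : EGraph n, wt q G * NH H G

/-- `N_H(K_n)`, the number of copies of `H` in the complete graph `K_n`. -/
def NHKn {k : ℕ} (H : SimpleGraph (Fin k)) (n : ℕ) : ℝ :=
  countCopies H (⊤ : SimpleGraph (Fin n))

/-- The lower tail event `L_p(H, η) = {G : N_H(G) ≤ η E[N_H(p)]}`. -/
def lowerTail {k : ℕ} (H : SimpleGraph (Fin k)) (n : ℕ) (p η : ℝ) : Set (EGraph n) :=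
  {G | NH H G ≤ η * expNH H (fun _ : Edge n => p)}

/-- `h(x) = x log x - x + 1` (with `h(0) = 1` since `Real.log 0 = 0`). -/
def hfun (x : ℝ) : ℝ := x * Real.log x - x + 1

/-- The relative entropy `i_p(t)` of `Ber(t)` with respect to `Ber(p)`. -/
def ip (p t : ℝ) : ℝ := t * Real.log (t / p) + (1 - t) * Real.log ((1 - t) / (1 - p))

/-- The number of edges of `H` as a real number. -/
def eH {k : ℕ} (H : SimpleGraph (Fin k)) : ℝ := H.edgeSet.ncard

/-- The defining equation of the threshold `η_H`, for a graph with `e` edges. -/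
def etaEq (e η : ℝ) : Prop :=
  hfun (η ^ (1 / η)) =
    hfun (η ^ (1 / e)) + η ^ (1 / e) * Real.log (η ^ (1 / e)) *
      (Real.log (η ^ (1 / η)) - Real.log (η ^ (1 / e)))

/-- The 2-density `m_2(H)`. -/
def m2 {k : ℕ} (H : SimpleGraph (Fin k)) : ℝ :=
  sSup {x : ℝ | ∃ F : H.Subgraph, 2 ≤ F.edgeSet.ncard ∧
    x = ((F.edgeSet.ncard : ℝ) - 1) / ((F.verts.ncard : ℝ) - 2)}

/-- The variational problem `Φ_p(H, η)`. -/
def PhiP {k : ℕ} (H : SimpleGraph (Fin k)) (n : ℕ) (p η : ℝ) : ℝ :=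
  sInf {x : ℝ | ∃ q : Edge n → ℝ, (∀ e, q e ∈ Set.Icc (0:ℝ) 1) ∧
    expNH H q ≤ η * expNH H (fun _ : Edge n => p) ∧ x = ∑ e : Edge n, ip p (q e)}

/-- The sparse limit variational problem `Φ(H, η)`. -/
def Phi {k : ℕ} (H : SimpleGraph (Fin k)) (n : ℕ) (η : ℝ) : ℝ :=
  sInf {x : ℝ | ∃ q : Edge n → ℝ, (∀ e, q e ∈ Set.Icc (0:ℝ) 1) ∧
    expNH H q ≤ η * NHKn H n ∧ x = ∑ e : Edge n, hfun (q e)}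

/-- The cut norm of an `n × n` real matrix. -/
def cutNorm {n : ℕ} (M : Matrix (Fin n) (Fin n) ℝ) : ℝ :=
  sSup {x : ℝ | ∃ a b : Fin n → ℝ, (∀ i, a i ∈ Set.Icc (0:ℝ) 1) ∧ (∀ i, b i ∈ Set.Icc (0:ℝ) 1) ∧
    x = |∑ i : Fin n, ∑ j : Fin n, a i * M i j * b j| / (n : ℝ) ^ 2}

/-- The symmetric matrix with entries `q_{ij} - c` off the diagonal, `0` on the diagonal. -/
def devMat {n : ℕ} (q : Edge n → ℝ) (c : ℝ) : Matrix (Fin n) (Fin n) ℝ :=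
  fun i j => if h : i = j then 0 else q ⟨s(i, j), by simp [Sym2.mk_isDiag_iff, h]⟩ - c

/-- The edge-indicator vector of `G` as a real vector. -/
def ind {n : ℕ} (G : EGraph n) : Edge n → ℝ := fun e => if G e then 1 else 0

/-- `Y_A = ∏_{e ∈ A} Y_e`. -/
def YA {n : ℕ} (A : Finset (Edge n)) (G : EGraph n) : ℝ :=
  ∏ e ∈ A, (if G e then (1:ℝ) else 0)

/-- The event that a configuration agrees with `G0` on the set `W`. -/
def agreeOn {n : ℕ} (W : Finset (Edge n)) (G0 : EGraph n) : Set (EGraph n) :=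
  {G | ∀ w ∈ W, G w = G0 w}

/-- The conditional expectation `E[f | (Y_w)_{w ∈ W}]` under the pmf `μ`, evaluated
at the outcome `G0` (i.e. given that `Y` agrees with `G0` on `W`). -/
def condExpW {n : ℕ} (μ : EGraph n → ℝ) (W : Finset (Edge n)) (f : EGraph n → ℝ)
    (G0 : EGraph n) : ℝ :=
  (∑ G : EGraph n, if G ∈ agreeOn W G0 then μ G * f G else 0) /
    (∑ G : EGraph n, if G ∈ agreeOn W G0 then μ G else 0)

/-- The pmf of `G(n, p)` conditioned on the lower tail event `L_p(H, η)`. -/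
def ltPMF {k : ℕ} (H : SimpleGraph (Fin k)) (n : ℕ) (p η : ℝ) : EGraph n → ℝ :=
  fun G => (if G ∈ lowerTail H n p η then wt (fun _ : Edge n => p) G else 0) /
    pr (fun _ : Edge n => p) (lowerTail H n p η)

/-- The hyperedges of the hypergraph `H(H)`: edge sets of copies of `H` in `K_n`. -/
def copySets {k : ℕ} (H : SimpleGraph (Fin k)) (n : ℕ) : Finset (Finset (Edge n)) :=
  Finset.univ.filter (fun A => ∃ f : Fin k ↪ Fin n,
    ∀ e : Edge n, e ∈ A ↔ ∃ u v : Fin k, H.Adj u v ∧ (e : Sym2 (Fin n)) = s(f u, f v))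

/-- The correlation `D_W(B, b)` as a random variable (a function of the outcome `G0`). -/
def DW {n : ℕ} (μ : EGraph n → ℝ) (W : Finset (Edge n)) (B : Finset (Edge n)) (b : Edge n)
    (G0 : EGraph n) : ℝ :=
  condExpW μ W (YA B) G0 - condExpW μ W (YA (B.erase b)) G0 * condExpW μ W (YA {b}) G0

/-- The energy `E_H(W)` of a set `W` with respect to the pmf `μ`. -/
def energy {k n : ℕ} (H : SimpleGraph (Fin k)) (μ : EGraph n → ℝ) (p : ℝ)
    (W : Finset (Edge n)) : ℝ :=
  ∑ G0 : EGraph n, μ G0 *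
    ∑ A ∈ (copySets H n).filter (fun A => Disjoint A W),
      ∑ B ∈ A.powerset.filter (fun B => 2 ≤ B.card),
        ∑ b ∈ B, (DW μ W B b G0) ^ 2 /
          ((Nat.choose H.edgeSet.ncard B.card : ℝ) * (B.card : ℝ) * p ^ (2 * B.card))

end LowerTails

namespace LowerTails

/-- The gap at `t` between `s ↦ hfun (exp s)` and its tangent line at `w`. -/
def tangentGap (w t : ℝ) : ℝ :=
  hfun (Real.exp t) - hfun (Real.exp w) - w * Real.exp w * (t - w)

lemma tangentGap_eq (w t : ℝ) : tangentGap w t =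
    Real.exp t * t - Real.exp t - (Real.exp w * w - Real.exp w) - w * Real.exp w * (t - w) := by
  simp only [tangentGap, hfun, Real.log_exp]; ring

lemma tangentGap_self (w : ℝ) : tangentGap w w = 0 := by simp [tangentGap]

lemma hasDerivAt_mul_exp (t : ℝ) :
    HasDerivAt (fun t => t * Real.exp t) ((1 + t) * Real.exp t) t := by
  refine ((hasDerivAt_id' t).mul (Real.hasDerivAt_exp t)).congr_deriv ?_
  ring

lemma hasDerivAt_tangentGap_right (w t : ℝ) :
    HasDerivAt (tangentGap w) (t * Real.exp t - w * Real.exp w) t := by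
  rw [funext (tangentGap_eq w)]
  have h1 := (Real.hasDerivAt_exp t).mul (hasDerivAt_id' t)
  have h2 := ((hasDerivAt_id' t).sub_const w).const_mul (w * Real.exp w)
  refine ((((h1.sub (Real.hasDerivAt_exp t)).sub_const
    (Real.exp w * w - Real.exp w)).sub h2)).congr_deriv ?_
  ring

lemma hasDerivAt_tangentGap_left (w t : ℝ) :
    HasDerivAt (fun w => tangentGap w t) ((w - t) * ((1 + w) * Real.exp w)) w := by
  simp only [tangentGap_eq]
  have h1 := (Real.hasDerivAt_exp w).mul (hasDerivAt_id' w)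
  have h2 := (hasDerivAt_mul_exp w).mul ((hasDerivAt_id' w).const_sub t)
  refine (((h1.sub (Real.hasDerivAt_exp w)).const_sub
    (Real.exp t * t - Real.exp t)).sub h2).congr_deriv ?_
  ring

lemma strictMonoOn_mul_exp : StrictMonoOn (fun t => t * Real.exp t) (Set.Ici (-1)) := by
  refine strictMonoOn_of_deriv_pos (convex_Ici _) (by fun_prop) fun t ht => ?_
  rw [interior_Ici, Set.mem_Ioi] at ht
  rw [(hasDerivAt_mul_exp t).deriv]
  exact mul_pos (by linarith) (Real.exp_pos t)

lemma strictAntiOn_mul_exp : StrictAntiOn (fun t => t * Real.exp t) (Set.Iic (-1)) := by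
  refine strictAntiOn_of_deriv_neg (convex_Iic _) (by fun_prop) fun t ht => ?_
  rw [interior_Iic, Set.mem_Iio] at ht
  rw [(hasDerivAt_mul_exp t).deriv]
  exact mul_neg_of_neg_of_pos (by linarith) (Real.exp_pos t)

lemma continuous_tangentGap (w : ℝ) : Continuous (tangentGap w) :=
  continuous_iff_continuousAt.2 fun t => (hasDerivAt_tangentGap_right w t).continuousAt

/-- Below the inflection point `-1` every tangent line lies above the curve. -/
lemma neg_one_lt_of_tangentGap_nonneg {w a : ℝ} (haw : a < w) (h : 0 ≤ tangentGap w a) :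
    -1 < w := by
  by_contra! hw
  have hmono : StrictMonoOn (tangentGap w) (Set.Iic w) := by
    refine strictMonoOn_of_deriv_pos (convex_Iic _) (continuous_tangentGap w).continuousOn
      fun t ht => ?_
    rw [interior_Iic, Set.mem_Iio] at ht
    rw [(hasDerivAt_tangentGap_right w t).deriv]
    exact sub_pos.2 (strictAntiOn_mul_exp (Set.mem_Iic.2 (by linarith)) hw ht)
  have := hmono (Set.mem_Iic.2 haw.le) (Set.mem_Iic.2 le_rfl) haw
  rw [tangentGap_self] at this
  linarith

lemma tangentGap_lt_of_lt {a u v : ℝ} (hau : a < u) (hu : -1 < u) (huv : u < v) :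
    tangentGap u a < tangentGap v a := by
  have hmono : StrictMonoOn (fun w => tangentGap w a) (Set.Icc u v) := by
    refine strictMonoOn_of_deriv_pos (convex_Icc _ _)
      (fun w _ => (hasDerivAt_tangentGap_left w a).continuousAt.continuousWithinAt)
      fun w hw => ?_
    rw [interior_Icc] at hw
    rw [(hasDerivAt_tangentGap_left w a).deriv]
    exact mul_pos (by linarith [hw.1]) (mul_pos (by linarith [hw.1]) (Real.exp_pos w))
  exact hmono ⟨le_rfl, huv.le⟩ ⟨huv.le, le_rfl⟩ huv

lemma tangentGap_pos {a v t : ℝ} (hv : -1 < v) (ha : 0 < tangentGap v a) (hat : a ≤ t)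
    (htv : t < v) : 0 < tangentGap v t := by
  have hanti : ∀ s, -1 ≤ s → s < v → 0 < tangentGap v s := by
    intro s hs hsv
    have hmono : StrictAntiOn (tangentGap v) (Set.Icc (-1) v) := by
      refine strictAntiOn_of_deriv_neg (convex_Icc _ _) (continuous_tangentGap v).continuousOn
        fun r hr => ?_
      rw [interior_Icc] at hr
      rw [(hasDerivAt_tangentGap_right v r).deriv]
      exact sub_neg.2 (strictMonoOn_mul_exp hr.1.le hv.le hr.2)
    have := hmono ⟨hs, hsv.le⟩ ⟨hv.le, le_rfl⟩ hsv
    rwa [tangentGap_self] at this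
  rcases le_or_gt (-1) t with ht | ht
  · exact hanti t ht htv
  have hconc : ConcaveOn ℝ (Set.Iic (-1)) (tangentGap v) := by
    refine AntitoneOn.concaveOn_of_deriv (convex_Iic _) (continuous_tangentGap v).continuousOn
      (fun r _ => (hasDerivAt_tangentGap_right v r).differentiableAt.differentiableWithinAt) ?_
    intro r hr s hs hrs
    rw [(hasDerivAt_tangentGap_right v r).deriv, (hasDerivAt_tangentGap_right v s).deriv]
    exact sub_le_sub_right (strictAntiOn_mul_exp.antitoneOn (interior_subset hr)
      (interior_subset hs) hrs) _
  have hmin := hconc.min_le_of_mem_Icc (x := a) (y := -1) (z := t)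
    (Set.mem_Iic.2 (hat.trans ht.le)) (Set.mem_Iic.2 le_rfl) ⟨hat, ht.le⟩
  exact (lt_min ha (hanti _ le_rfl hv)).trans_le hmin

/-- The quadratic lower bound for the tangent gap to the right of the inflection point. -/
lemma mul_sq_le_tangentGap {s v t : ℝ} (hs : -1 ≤ s) (hst : s ≤ t) (hsv : s ≤ v) (hv : v ≤ 0)
    (ht : t ≤ 0) : (1 + s) * Real.exp (-1) / 2 * (t - v) ^ 2 ≤ tangentGap v t := by
  set κ := (1 + s) * Real.exp (-1) / 2 with hκ
  have hp : MonotoneOn (fun t => t * Real.exp t - 2 * κ * t) (Set.Icc s 0) := by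
    have hd : ∀ r, HasDerivAt (fun t => t * Real.exp t - 2 * κ * t)
        ((1 + r) * Real.exp r - 2 * κ * 1) r := fun r =>
      (hasDerivAt_mul_exp r).sub ((hasDerivAt_id' r).const_mul (2 * κ))
    refine monotoneOn_of_deriv_nonneg (convex_Icc _ _) (by fun_prop)
      (fun r _ => (hd r).differentiableAt.differentiableWithinAt) fun r hr => ?_
    rw [interior_Icc] at hr
    rw [(hd r).deriv]
    have : (1 + s) * Real.exp (-1) ≤ (1 + r) * Real.exp r :=
      mul_le_mul (by linarith [hr.1]) (Real.exp_le_exp.2 (by linarith [hr.1]))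
        (Real.exp_pos _).le (by linarith [hr.1])
    linarith
  have hd : ∀ r, HasDerivAt (fun t => tangentGap v t - κ * (t - v) ^ 2)
      (r * Real.exp r - 2 * κ * r - (v * Real.exp v - 2 * κ * v)) r := fun r => by
    refine ((hasDerivAt_tangentGap_right v r).sub
      ((((hasDerivAt_id' r).sub_const v).pow 2).const_mul κ)).congr_deriv ?_
    norm_num
    ring
  have hcont : Continuous (fun t => tangentGap v t - κ * (t - v) ^ 2) :=
    continuous_iff_continuousAt.2 fun r => (hd r).continuousAt
  have hzero : tangentGap v v - κ * (v - v) ^ 2 = 0 := by simp [tangentGap_self]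
  suffices h : tangentGap v v - κ * (v - v) ^ 2 ≤ tangentGap v t - κ * (t - v) ^ 2 by linarith
  rcases le_total t v with htv | htv
  · have hm : AntitoneOn (fun t => tangentGap v t - κ * (t - v) ^ 2) (Set.Icc s v) := by
      refine antitoneOn_of_deriv_nonpos (convex_Icc _ _) hcont.continuousOn
        (fun r _ => (hd r).differentiableAt.differentiableWithinAt) fun r hr => ?_
      rw [interior_Icc] at hr
      rw [(hd r).deriv]
      exact sub_nonpos.2 (hp ⟨hr.1.le, hr.2.le.trans hv⟩ ⟨hsv, hv⟩ hr.2.le)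
    exact hm ⟨hst, htv⟩ ⟨hsv, le_rfl⟩ htv
  · have hm : MonotoneOn (fun t => tangentGap v t - κ * (t - v) ^ 2) (Set.Icc v 0) := by
      refine monotoneOn_of_deriv_nonneg (convex_Icc _ _) hcont.continuousOn
        (fun r _ => (hd r).differentiableAt.differentiableWithinAt) fun r hr => ?_
      rw [interior_Icc] at hr
      rw [(hd r).deriv]
      exact sub_nonneg.2 (hp ⟨hsv, hv⟩ ⟨hsv.trans hr.1.le, hr.2.le⟩ hr.1.le)
    exact hm ⟨le_rfl, hv⟩ ⟨htv, ht⟩ htv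

lemma exists_mul_sq_le_tangentGap {a v : ℝ} (hav : a < v) (hv : v < 0)
    (hpos : 0 < tangentGap v a) :
    ∃ κ > 0, ∀ t ∈ Set.Icc a 0, κ * (t - v) ^ 2 ≤ tangentGap v t := by
  have hv1 := neg_one_lt_of_tangentGap_nonneg hav hpos.le
  obtain ⟨s, hs1, hsv⟩ := exists_between hv1
  have hκ₁ : 0 < (1 + s) * Real.exp (-1) / 2 := by
    have := Real.exp_pos (-1)
    have : 0 < 1 + s := by linarith
    positivity
  obtain ⟨b, hb, hbound⟩ : ∃ b > 0, ∀ t ∈ Set.Icc a s, b ≤ tangentGap v t := by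
    rcases le_or_gt a s with has | has
    · obtain ⟨x, hx, hmin⟩ := isCompact_Icc.exists_isMinOn (Set.nonempty_Icc.2 has)
        (continuous_tangentGap v).continuousOn
      exact ⟨_, tangentGap_pos hv1 hpos hx.1 (hx.2.trans_lt hsv), fun t ht => hmin ht⟩
    · exact ⟨1, one_pos, fun t ht => absurd (ht.1.trans ht.2) (not_le.2 has)⟩
  have ha : 0 < a ^ 2 := by nlinarith
  refine ⟨min ((1 + s) * Real.exp (-1) / 2) (b / a ^ 2), lt_min hκ₁ (by positivity),
    fun t ht => ?_⟩
  rcases le_total s t with hst | hst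
  · refine le_trans (mul_le_mul_of_nonneg_right (min_le_left _ _) (sq_nonneg _)) ?_
    exact mul_sq_le_tangentGap hs1.le hst hsv.le hv.le ht.2
  · refine le_trans (mul_le_mul_of_nonneg_right (min_le_right _ _) (sq_nonneg _)) ?_
    refine le_trans ?_ (hbound t ⟨ht.1, hst⟩)
    have : (t - v) ^ 2 ≤ a ^ 2 := by nlinarith [ht.1]
    calc b / a ^ 2 * (t - v) ^ 2 ≤ b / a ^ 2 * a ^ 2 := by gcongr
      _ = b := div_mul_cancel₀ b ha.ne'

lemma sq_exp_sub_exp_le {t v : ℝ} (ht : t ≤ 0) (hv : v ≤ 0) :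
    (Real.exp t - Real.exp v) ^ 2 ≤ (t - v) ^ 2 := by
  wlog h : v ≤ t generalizing t v
  · have := this hv ht (le_of_not_ge h)
    nlinarith
  have h1 : Real.exp v = Real.exp t * Real.exp (v - t) := by rw [← Real.exp_add]; ring_nf
  have h2 := Real.add_one_le_exp (v - t)
  have h3 := Real.exp_le_one_iff.2 ht
  have h4 := Real.exp_pos t
  have h5 : Real.exp v ≤ Real.exp t := Real.exp_le_exp.2 h
  have h6 : Real.exp t - Real.exp v ≤ t - v := by nlinarith
  exact pow_le_pow_left₀ (by linarith) h6 2

/-- The curve `hfun` lies quadratically above its tangent in the logarithmic variable. -/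
lemma exists_mul_sq_le_hfun {a u v : ℝ} (hau : a < u) (huv : u < v) (hv : v < 0)
    (h : 0 ≤ tangentGap u a) :
    ∃ κ > 0, ∀ x ∈ Set.Icc (Real.exp a) 1, κ * (x - Real.exp v) ^ 2 ≤
      hfun x - hfun (Real.exp v) - v * Real.exp v * (Real.log x - v) := by
  have hu := neg_one_lt_of_tangentGap_nonneg hau h
  obtain ⟨κ, hκ, hb⟩ := exists_mul_sq_le_tangentGap (hau.trans huv) hv
    (h.trans_lt (tangentGap_lt_of_lt hau hu huv))
  refine ⟨κ, hκ, fun x hx => ?_⟩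
  have hx0 : 0 < x := (Real.exp_pos a).trans_le hx.1
  have hl : Real.log x ≤ 0 := Real.log_nonpos hx0.le hx.2
  have h1 := hb (Real.log x) ⟨(Real.le_log_iff_exp_le hx0).2 hx.1, hl⟩
  have h2 := sq_exp_sub_exp_le hl hv.le
  rw [tangentGap, Real.exp_log hx0] at h1
  rw [Real.exp_log hx0] at h2
  exact (mul_le_mul_of_nonneg_left h2 hκ.le).trans h1

lemma hfun_ge_tangent {x a : ℝ} (hx : 0 ≤ x) (ha : 0 < a) :
    hfun a + Real.log a * (x - a) ≤ hfun x := by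
  rcases hx.eq_or_lt with rfl | hx
  · simp only [hfun]; nlinarith
  have h1 := Real.add_one_le_exp (Real.log a - Real.log x)
  rw [Real.exp_sub, Real.exp_log ha, Real.exp_log hx, le_div_iff₀ hx] at h1
  simp only [hfun]
  nlinarith

lemma hfun_nonneg {x : ℝ} (hx : 0 ≤ x) : 0 ≤ hfun x := by
  have := hfun_ge_tangent hx one_pos
  simpa [hfun] using this

lemma hfun_le_of_le {x y : ℝ} (hx : 0 ≤ x) (hxy : x ≤ y) (hy0 : 0 < y) (hy : y ≤ 1) :
    hfun y ≤ hfun x := by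
  have := hfun_ge_tangent hx hy0
  nlinarith [Real.log_nonpos hy0.le hy]

lemma hfun_mul_le {r y : ℝ} (hr : 0 < r) (hy : 0 < y) :
    hfun (r * y) ≤ hfun y + (1 - r) * (-(y * Real.log y) + y * -Real.log r) := by
  have := hfun_ge_tangent hy.le (mul_pos hr hy)
  rw [Real.log_mul hr.ne' hy.ne'] at this
  nlinarith

section Hypergraph

variable {E ι : Type}

lemma prod_le_prod_add_sum {A : Finset E} {q y : E → ℝ} (hq : ∀ e, 0 ≤ q e)
    (hqy : ∀ e, q e ≤ y e) (hy : ∀ e, y e ≤ 1) :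
    ∏ e ∈ A, y e ≤ ∏ e ∈ A, q e + ∑ e ∈ A, (y e - q e) := by
  classical
  induction A using Finset.induction_on with
  | empty => simp
  | insert a A ha ih =>
    rw [Finset.prod_insert ha, Finset.prod_insert ha, Finset.sum_insert ha]
    have h1 : ∏ e ∈ A, q e ≤ 1 :=
      Finset.prod_le_one (fun e _ => hq e) fun e _ => (hqy e).trans (hy e)
    have h2 : 0 ≤ ∏ e ∈ A, q e := Finset.prod_nonneg fun e _ => hq e
    have h3 : 0 ≤ ∑ e ∈ A, (y e - q e) := Finset.sum_nonneg fun e _ => sub_nonneg.2 (hqy e)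
    have h4 : 0 ≤ y a := (hq a).trans (hqy a)
    calc y a * ∏ e ∈ A, y e ≤ y a * (∏ e ∈ A, q e + ∑ e ∈ A, (y e - q e)) := by gcongr
      _ = q a * ∏ e ∈ A, q e + (y a - q a) * ∏ e ∈ A, q e
          + y a * ∑ e ∈ A, (y e - q e) := by ring
      _ ≤ q a * ∏ e ∈ A, q e + (y a - q a) * 1 + 1 * ∑ e ∈ A, (y e - q e) := by
        have := hqy a
        have := hy a
        gcongr
      _ = _ := by ring

variable [Fintype ι] {A : ι → Finset E} {m d : ℕ}

lemma sum_prod_const_mul (hcard : ∀ i, (A i).card = m) (r : ℝ) (y : E → ℝ) :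
    ∑ i, ∏ e ∈ A i, r * y e = r ^ m * ∑ i, ∏ e ∈ A i, y e := by
  simp_rw [Finset.prod_mul_distrib, Finset.prod_const, hcard, Finset.mul_sum]

variable [Fintype E]

lemma card_mul_hfun_ge (hcard : ∀ i, (A i).card = m) {η c Φ : ℝ} (hc0 : 0 < c) (hc1 : c ≤ 1)
    (hcη : c ^ m = η)
    (hΦ : ∀ q : E → ℝ, (∀ e, q e ∈ Set.Icc (0 : ℝ) 1) →
      ∑ i, ∏ e ∈ A i, q e ≤ η * Fintype.card ι → Φ ≤ ∑ e, hfun (q e)) :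
    Φ ≤ Fintype.card E * hfun c := by
  have := hΦ (fun _ => c) (fun _ => ⟨hc0.le, hc1⟩) (by simp [hcard, hcη, mul_comm])
  simpa using this

variable [DecidableEq E]

lemma sum_sum_mem_eq (hdeg : ∀ e, (Finset.univ.filter fun i => e ∈ A i).card = d) (f : E → ℝ) :
    ∑ i, ∑ e ∈ A i, f e = d * ∑ e, f e := by
  have h : ∀ i, ∑ e ∈ A i, f e = ∑ e, if e ∈ A i then f e else 0 := fun i => by
    rw [← Finset.sum_filter]; simp
  simp_rw [h]
  rw [Finset.sum_comm, Finset.mul_sum]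
  refine Finset.sum_congr rfl fun e _ => ?_
  rw [← Finset.sum_filter, Finset.sum_const, hdeg, nsmul_eq_mul]

lemma card_mul_eq (hcard : ∀ i, (A i).card = m)
    (hdeg : ∀ e, (Finset.univ.filter fun i => e ∈ A i).card = d) :
    (m : ℝ) * Fintype.card ι = d * Fintype.card E := by
  have := sum_sum_mem_eq hdeg fun _ => 1
  simp only [Finset.sum_const, nsmul_eq_mul, hcard, mul_one, Finset.card_univ] at this
  linarith

lemma sum_prod_le_add (hdeg : ∀ e, (Finset.univ.filter fun i => e ∈ A i).card = d)
    {q y : E → ℝ} (hq : ∀ e, 0 ≤ q e) (hqy : ∀ e, q e ≤ y e) (hy : ∀ e, y e ≤ 1) :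
    ∑ i, ∏ e ∈ A i, y e ≤ ∑ i, ∏ e ∈ A i, q e + d * ∑ e, (y e - q e) := by
  rw [← sum_sum_mem_eq hdeg, ← Finset.sum_add_distrib]
  exact Finset.sum_le_sum fun i _ => prod_le_prod_add_sum hq hqy hy

/-- Jensen's inequality for the average of the products, in logarithmic form. -/
lemma sum_log_le [Nonempty ι] (hm : 0 < m) (hcard : ∀ i, (A i).card = m)
    (hdeg : ∀ e, (Finset.univ.filter fun i => e ∈ A i).card = d) {z : E → ℝ} (hz : ∀ e, 0 < z e)
    {θ : ℝ} (hθ : 0 < θ) (h : ∑ i, ∏ e ∈ A i, z e ≤ θ * Fintype.card ι) :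
    ∑ e, Real.log (z e) ≤ Fintype.card E * (Real.log θ / m) := by
  have hI : (0 : ℝ) < Fintype.card ι := by exact_mod_cast Fintype.card_pos
  have hm' : (0 : ℝ) < m := by exact_mod_cast hm
  have h1 : ∀ i, θ * (1 - Real.log θ) + θ * ∑ e ∈ A i, Real.log (z e) ≤ ∏ e ∈ A i, z e := by
    intro i
    have h2 : 0 < ∏ e ∈ A i, z e := Finset.prod_pos fun e _ => hz e
    have h3 := Real.add_one_le_exp (Real.log (∏ e ∈ A i, z e) - Real.log θ)
    rw [Real.exp_sub, Real.exp_log h2, Real.exp_log hθ, le_div_iff₀ hθ,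
      Real.log_prod fun e _ => (hz e).ne'] at h3
    linarith
  have h4 := (Finset.sum_le_sum fun i (_ : i ∈ Finset.univ) => h1 i).trans h
  rw [Finset.sum_add_distrib, ← Finset.mul_sum _ fun i => ∑ e ∈ A i, Real.log (z e),
    sum_sum_mem_eq hdeg, Finset.sum_const,
    Finset.card_univ, nsmul_eq_mul] at h4
  have h5 : (d : ℝ) * ∑ e, Real.log (z e) ≤ Fintype.card ι * Real.log θ := by
    refine le_of_mul_le_mul_left ?_ hθ
    linarith
  have h6 := card_mul_eq hcard hdeg
  have hd : (0 : ℝ) < d := by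
    rcases (Nat.cast_nonneg d : (0 : ℝ) ≤ d).eq_or_lt with h0 | h0
    · rw [← h0, zero_mul] at h6
      exact absurd h6 (mul_pos hm' hI).ne'
    · exact h0
  refine le_of_mul_le_mul_left (h5.trans_eq ?_) hd
  field_simp
  linear_combination Real.log θ * h6

set_option maxHeartbeats 1000000 in
/-- A near-optimal vector has few coordinates below the threshold `x₀`. -/
lemma card_small_le [Nonempty E] (hcard : ∀ i, (A i).card = m)
    (hdeg : ∀ e, (Finset.univ.filter fun i => e ∈ A i).card = d) {η c Φ δ x₀ t : ℝ}
    (hη0 : 0 < η) (hc0 : 0 < c) (hc1 : c < 1)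
    (hcη : c ^ m = η) (hx₀ : 0 < x₀) (ht0 : 0 < t) (ht1 : x₀ + t ≤ 1)
    (hΦ : ∀ q : E → ℝ, (∀ e, q e ∈ Set.Icc (0 : ℝ) 1) →
      ∑ i, ∏ e ∈ A i, q e ≤ η * Fintype.card ι → Φ ≤ ∑ e, hfun (q e))
    {q : E → ℝ} (hq : ∀ e, q e ∈ Set.Icc (0 : ℝ) 1)
    (hqη : ∑ i, ∏ e ∈ A i, q e ≤ η * Fintype.card ι)
    (hδ : ∑ e, hfun (q e) ≤ Φ + δ * Fintype.card E) :
    ((Finset.univ.filter fun e => q e < x₀).card : ℝ) *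
      (t * (-Real.log x₀ - t / x₀ - (δ / -Real.log c + -Real.log c + t / η) / η)) ≤
      δ * Fintype.card E := by
  set S := Finset.univ.filter fun e => q e < x₀ with hS
  set s := (S.card : ℝ) with hs
  set M := (Fintype.card E : ℝ) with hM
  set L := -Real.log c with hL
  have hL0 : 0 < L := neg_pos.2 (Real.log_neg hc0 hc1)
  have hM0 : 0 < M := by rw [hM]; exact_mod_cast Fintype.card_pos
  have hs0 : 0 ≤ s := Nat.cast_nonneg _
  have hsM : s ≤ M := by rw [hs, hM]; exact_mod_cast Finset.card_le_univ S
  set y : E → ℝ := fun e => q e + if e ∈ S then t else 0 with hy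
  have hqy : ∀ e, q e ≤ y e := fun e => by
    simp only [hy]; split_ifs <;> linarith
  have hyS : ∀ e ∈ S, y e ≤ x₀ + t := fun e he => by
    simp only [hy, if_pos he]
    have := (Finset.mem_filter.1 he).2
    linarith
  have hy1 : ∀ e, y e ≤ 1 := fun e => by
    by_cases he : e ∈ S
    · exact (hyS e he).trans ht1
    · simp only [hy, if_neg he, add_zero]; exact (hq e).2
  have hy0 : ∀ e, 0 < y e := fun e => by
    by_cases he : e ∈ S
    · simp only [hy, if_pos he]; linarith [(hq e).1]
    · simp only [hy, if_neg he, add_zero]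
      have : ¬ q e < x₀ := fun h => he (Finset.mem_filter.2 ⟨Finset.mem_univ _, h⟩)
      linarith
  have hind : ∀ a : ℝ, ∑ e, (if e ∈ S then a else 0) = s * a := fun a => by
    rw [Finset.sum_ite_mem, Finset.univ_inter, Finset.sum_const, nsmul_eq_mul]
  -- the rescaled vector is feasible
  set τ := t * s / (M * η) with hτ
  have hτ0 : 0 ≤ τ := by positivity
  have hτt : τ ≤ t / η := by
    rw [hτ, div_le_div_iff₀ (by positivity) hη0]
    nlinarith [mul_nonneg (mul_nonneg ht0.le hη0.le) (sub_nonneg.2 hsM)]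
  set r := 1 / (1 + τ) with hr
  have h1τ : 0 < 1 + τ := by linarith
  have hr0 : 0 < r := by positivity
  have hr1 : r ≤ 1 := by rw [hr, div_le_one h1τ]; linarith
  have hrτ : 1 - r ≤ τ := by
    have : 1 - r = τ * r := by rw [hr]; field_simp; ring
    rw [this]; nlinarith
  have hlogr : -Real.log r ≤ t / η := by
    rw [hr, one_div, Real.log_inv, neg_neg]
    linarith [Real.log_le_sub_one_of_pos h1τ]
  have hfeas : ∑ i, ∏ e ∈ A i, r * y e ≤ η * Fintype.card ι := by
    rw [sum_prod_const_mul hcard]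
    have h1 := sum_prod_le_add hdeg (fun e => (hq e).1) hqy hy1
    have h2 : ∑ e, (y e - q e) = s * t := by
      simp only [hy, add_sub_cancel_left]; exact hind t
    have h3 := card_mul_eq hcard hdeg
    rw [h2] at h1
    have h4 : (1 : ℝ) + m * τ ≤ (1 + τ) ^ m := one_add_mul_le_pow (by linarith) m
    have h5 : (d : ℝ) * (s * t) = η * Fintype.card ι * (m * τ) := by
      have : η * Fintype.card ι * (m * τ) = (m * Fintype.card ι) * (η * τ) := by ring
      rw [this, h3, hτ]
      field_simp
      ring
    have h6 : (0 : ℝ) ≤ η * Fintype.card ι := by positivity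
    rw [hr, div_pow, one_pow, one_div, inv_mul_le_iff₀ (by positivity)]
    nlinarith
  have hΦr := hΦ (fun e => r * y e) (fun e => ⟨by have := hy0 e; positivity, by
    have := hy0 e; have := hy1 e; nlinarith⟩) hfeas
  -- the entropy of the rescaled vector
  have hΦc := card_mul_hfun_ge hcard hc0 hc1.le hcη hΦ
  have hsumq : M * c - ∑ e, y e ≤ δ / L * M := by
    have h1 : ∑ e, (hfun c + Real.log c * (q e - c)) ≤ ∑ e, hfun (q e) :=
      Finset.sum_le_sum fun e _ => hfun_ge_tangent (hq e).1 hc0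
    rw [Finset.sum_add_distrib, ← Finset.mul_sum, Finset.sum_sub_distrib] at h1
    simp only [Finset.sum_const, Finset.card_univ, nsmul_eq_mul] at h1
    have h2 : ∑ e, q e ≤ ∑ e, y e := Finset.sum_le_sum fun e _ => hqy e
    have h3 : L * (M * c - ∑ e, q e) ≤ δ * M := by rw [hL]; linarith
    have h4 : M * c - ∑ e, q e ≤ δ * M / L := by
      rw [le_div_iff₀ hL0]; linarith
    have h5 : δ / L * M = δ * M / L := by ring
    linarith
  have hsumy : ∑ e, y e ≤ M := by
    refine (Finset.sum_le_sum fun e _ => hy1 e).trans_eq ?_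
    simp [hM]
  have hent : ∑ e, -(y e * Real.log (y e)) ≤ (δ / L + L) * M := by
    have h1 : ∀ e, -(y e * Real.log (y e)) ≤ c - y e + y e * L := fun e => by
      have := hfun_ge_tangent (hy0 e).le hc0
      simp only [hfun] at this
      rw [hL]; linarith
    have h2 := Finset.sum_le_sum fun e (_ : e ∈ Finset.univ) => h1 e
    rw [Finset.sum_add_distrib, Finset.sum_sub_distrib, ← Finset.sum_mul] at h2
    simp only [Finset.sum_const, Finset.card_univ, nsmul_eq_mul] at h2
    nlinarith
  have hhy : ∑ e, hfun (y e) ≤ ∑ e, hfun (q e) - s * (t * (-Real.log x₀ - t / x₀)) := by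
    rw [← hind, ← Finset.sum_sub_distrib]
    refine Finset.sum_le_sum fun e _ => ?_
    by_cases he : e ∈ S
    · have h1 := hfun_ge_tangent (hq e).1 (hy0 e)
      have h2 : q e - y e = -t := by simp [hy, he]
      have h3 : Real.log (y e) ≤ Real.log x₀ + t / x₀ := by
        have h4 := Real.log_le_sub_one_of_pos (div_pos (hy0 e) hx₀)
        rw [Real.log_div (hy0 e).ne' hx₀.ne'] at h4
        have h5 : y e / x₀ ≤ 1 + t / x₀ := by
          rw [div_le_iff₀ hx₀, add_mul, div_mul_cancel₀ _ hx₀.ne']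
          linarith [hyS e he]
        linarith
      rw [h2] at h1
      rw [if_pos he]
      nlinarith
    · simp [hy, he]
  have hmul : ∑ e, hfun (r * y e) ≤ ∑ e, hfun (y e) + τ * ((δ / L + L + t / η) * M) := by
    have h1 := Finset.sum_le_sum fun e (_ : e ∈ Finset.univ) => hfun_mul_le hr0 (hy0 e)
    rw [Finset.sum_add_distrib, ← Finset.mul_sum, Finset.sum_add_distrib, ← Finset.sum_mul] at h1
    have h2 : 0 ≤ ∑ e, -(y e * Real.log (y e)) := Finset.sum_nonneg fun e _ => by
      have := Real.log_nonpos (hy0 e).le (hy1 e)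
      have := hy0 e
      nlinarith
    have h3 : 0 ≤ ∑ e, y e := Finset.sum_nonneg fun e _ => (hy0 e).le
    have h4 : 0 ≤ -Real.log r := neg_nonneg.2 (Real.log_nonpos hr0.le hr1)
    have h5 : (∑ e, y e) * -Real.log r ≤ M * (t / η) :=
      mul_le_mul hsumy hlogr h4 hM0.le
    have h6 : (1 - r) * (∑ e, -(y e * Real.log (y e)) + (∑ e, y e) * -Real.log r) ≤
        τ * ((δ / L + L + t / η) * M) := by
      refine mul_le_mul hrτ ?_ (by positivity) hτ0
      linarith
    linarith
  have hτM : τ * ((δ / L + L + t / η) * M) = s * (t * ((δ / L + L + t / η) / η)) := by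
    have h1 : τ * M = t * s / η := by rw [hτ]; field_simp
    generalize δ / L + L + t / η = X
    calc τ * (X * M) = τ * M * X := by ring
      _ = s * (t * (X / η)) := by rw [h1]; ring
  rw [hτM] at hmul
  have hexp : s * (t * (-Real.log x₀ - t / x₀ - (δ / L + L + t / η) / η)) =
      s * (t * (-Real.log x₀ - t / x₀)) - s * (t * ((δ / L + L + t / η) / η)) := by ring
  rw [hexp]
  linarith

/-- Near-optimal vectors are close to the constant vector in the quadratic mean, given a
bound on the number of small coordinates. -/
lemma sum_sq_sub_le [Nonempty E] [Nonempty ι] (hm : 0 < m) (hcard : ∀ i, (A i).card = m)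
    (hdeg : ∀ e, (Finset.univ.filter fun i => e ∈ A i).card = d) {η c Φ δ x₀ κ σ : ℝ}
    (hη0 : 0 < η) (hc0 : 0 < c) (hc1 : c < 1)
    (hcη : c ^ m = η) (hx₀ : 0 < x₀) (hx₁ : x₀ ≤ 1) (hκ : 0 < κ)
    (htan : ∀ x ∈ Set.Icc x₀ 1, κ * (x - c) ^ 2 ≤
      hfun x - hfun c - Real.log c * c * (Real.log x - Real.log c))
    (hΦ : ∀ q : E → ℝ, (∀ e, q e ∈ Set.Icc (0 : ℝ) 1) →
      ∑ i, ∏ e ∈ A i, q e ≤ η * Fintype.card ι → Φ ≤ ∑ e, hfun (q e))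
    {q : E → ℝ} (hq : ∀ e, q e ∈ Set.Icc (0 : ℝ) 1)
    (hqη : ∑ i, ∏ e ∈ A i, q e ≤ η * Fintype.card ι)
    (hδ : ∑ e, hfun (q e) ≤ Φ + δ * Fintype.card E)
    (hσ : ((Finset.univ.filter fun e => q e < x₀).card : ℝ) = σ * Fintype.card E) :
    ∑ e, (q e - c) ^ 2 ≤
      2 * ((δ + -Real.log c * c * (σ / η)) / κ + σ) * Fintype.card E := by
  set S := Finset.univ.filter fun e => q e < x₀ with hS
  set M := (Fintype.card E : ℝ) with hM
  have hL0 : 0 < -Real.log c := neg_pos.2 (Real.log_neg hc0 hc1)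
  have hM0 : 0 < M := by rw [hM]; exact_mod_cast Fintype.card_pos
  have hm' : (0 : ℝ) < m := by exact_mod_cast hm
  have hσ0 : 0 ≤ σ := by
    by_contra! h
    have : (0 : ℝ) ≤ S.card := Nat.cast_nonneg _
    nlinarith
  set z : E → ℝ := fun e => max (q e) x₀ with hz
  have hz0 : ∀ e, 0 < z e := fun e => hx₀.trans_le (le_max_right _ _)
  have hz1 : ∀ e, z e ≤ 1 := fun e => max_le (hq e).2 hx₁
  have hqz : ∀ e, q e ≤ z e := fun e => le_max_left _ _
  have hzS : ∀ e, z e - q e ≤ if e ∈ S then 1 else 0 := fun e => by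
    by_cases he : e ∈ S
    · rw [if_pos he]; linarith [hz1 e, (hq e).1]
    · have : ¬ q e < x₀ := fun h => he (Finset.mem_filter.2 ⟨Finset.mem_univ _, h⟩)
      simp [he, hz, not_lt.1 this]
  have hsum : ∑ e, (z e - q e) ≤ σ * M := by
    refine (Finset.sum_le_sum fun e _ => hzS e).trans_eq ?_
    rw [Finset.sum_ite_mem, Finset.univ_inter, Finset.sum_const, nsmul_eq_mul, mul_one, hσ]
  have hlog : ∑ e, Real.log (z e) ≤ M * (Real.log c + σ / η) := by
    have h1 := sum_prod_le_add hdeg (fun e => (hq e).1) hqz hz1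
    have h2 : (d : ℝ) * ∑ e, (z e - q e) ≤ m * σ * Fintype.card ι := by
      calc (d : ℝ) * ∑ e, (z e - q e) ≤ d * (σ * M) := by gcongr
        _ = d * M * σ := by ring
        _ = m * σ * Fintype.card ι := by rw [← card_mul_eq hcard hdeg]; ring
    have hθ : 0 < η + m * σ := by positivity
    refine (sum_log_le hm hcard hdeg hz0 hθ (by linarith)).trans ?_
    refine mul_le_mul_of_nonneg_left ?_ hM0.le
    have h3 := Real.log_le_sub_one_of_pos (div_pos hθ hη0)
    rw [Real.log_div hθ.ne' hη0.ne', add_div, div_self hη0.ne'] at h3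
    have h4 : Real.log η = m * Real.log c := by rw [← hcη, Real.log_pow]
    rw [div_le_iff₀ hm', add_mul]
    have h5 : σ / η * m = m * σ / η := by ring
    linarith
  have hΦc := card_mul_hfun_ge hcard hc0 hc1.le hcη hΦ
  have hh : ∑ e, hfun (z e) ≤ M * hfun c + δ * M :=
    (Finset.sum_le_sum fun e _ => hfun_le_of_le (hq e).1 (hqz e) (hz0 e) (hz1 e)).trans
      (hδ.trans (by linarith))
  have hzc : ∑ e, (z e - c) ^ 2 ≤ (δ + -Real.log c * c * (σ / η)) / κ * M := by
    have h1 := Finset.sum_le_sum fun e (_ : e ∈ Finset.univ) =>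
      htan (z e) ⟨le_max_right _ _, hz1 e⟩
    rw [← Finset.mul_sum, Finset.sum_sub_distrib, Finset.sum_sub_distrib, ← Finset.mul_sum,
      Finset.sum_sub_distrib] at h1
    simp only [Finset.sum_const, Finset.card_univ, nsmul_eq_mul] at h1
    rw [div_mul_eq_mul_div, le_div_iff₀ hκ]
    have h2 : (-Real.log c * c) * (∑ e, Real.log (z e) - M * Real.log c) ≤
        (-Real.log c * c) * (M * (σ / η)) :=
      mul_le_mul_of_nonneg_left (by linarith) (by positivity)
    linarith
  have hfin : ∀ e, (q e - c) ^ 2 ≤ 2 * (z e - c) ^ 2 + 2 * (z e - q e) := fun e => by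
    have h1 := hqz e
    have h2 := hz1 e
    have h3 := (hq e).1
    nlinarith [sq_nonneg ((z e - c) + (z e - q e))]
  refine (Finset.sum_le_sum fun e _ => hfin e).trans ?_
  rw [Finset.sum_add_distrib, ← Finset.mul_sum, ← Finset.mul_sum]
  linarith

end Hypergraph

lemma tangentGap_eq_zero_of_etaEq {e η : ℝ} (hη : 0 < η) (h : etaEq e η) :
    tangentGap (Real.log η / e) (Real.log η / η) = 0 := by
  have hpow : ∀ x : ℝ, η ^ (1 / x) = Real.exp (Real.log η / x) := fun x => by
    rw [Real.rpow_def_of_pos hη, mul_one_div]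
  simp only [etaEq, hpow, Real.log_exp] at h
  rw [tangentGap, h]
  ring

/-- Stability of the variational problem for regular uniform hypergraphs. -/
lemma exists_sum_sq_sub_le {m : ℕ} (hm : 0 < m) {ηs η : ℝ} (hηs : 0 < ηs) (hlt : ηs < η)
    (hη1 : η < 1) (hEq : etaEq m ηs) :
    ∃ K > 0, ∃ δ₀ > 0, ∀ {E ι : Type} [Fintype E] [Fintype ι] [DecidableEq E] [Nonempty E]
      [Nonempty ι] {A : ι → Finset E} {d : ℕ}, (∀ i, (A i).card = m) →
      (∀ e, (Finset.univ.filter fun i => e ∈ A i).card = d) → ∀ {Φ δ : ℝ}, 0 ≤ δ → δ ≤ δ₀ →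
      (∀ q : E → ℝ, (∀ e, q e ∈ Set.Icc (0 : ℝ) 1) →
        ∑ i, ∏ e ∈ A i, q e ≤ η * Fintype.card ι → Φ ≤ ∑ e, hfun (q e)) →
      ∀ q : E → ℝ, (∀ e, q e ∈ Set.Icc (0 : ℝ) 1) →
        ∑ i, ∏ e ∈ A i, q e ≤ η * Fintype.card ι →
        ∑ e, hfun (q e) ≤ Φ + δ * Fintype.card E →
        ∑ e, (q e - η ^ (1 / (m : ℝ))) ^ 2 ≤ K * δ * Fintype.card E := by
  have hη0 : 0 < η := hηs.trans hlt
  have hm' : (1 : ℝ) ≤ m := by exact_mod_cast hm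
  set c := η ^ (1 / (m : ℝ)) with hc
  have hc0 : 0 < c := Real.rpow_pos_of_pos hη0 _
  have hlogc : Real.log c = Real.log η / m := by rw [hc, Real.log_rpow hη0]; ring
  have hℓ : Real.log η < 0 := Real.log_neg hη0 hη1
  have hℓs : Real.log ηs < Real.log η := Real.log_lt_log hηs hlt
  have hv : Real.log c < 0 := by rw [hlogc]; exact div_neg_of_neg_of_pos hℓ (by linarith)
  have hc1 : c < 1 := (Real.log_neg_iff hc0).1 hv
  have hcη : c ^ m = η := by
    rw [hc, ← Real.rpow_natCast, ← Real.rpow_mul hη0.le, one_div_mul_cancel (by positivity),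
      Real.rpow_one]
  set L := -Real.log c with hL
  have hL0 : 0 < L := neg_pos.2 hv
  have hLℓ : L ≤ -Real.log η := by
    rw [hL, hlogc, ← neg_div]
    exact div_le_self (by linarith) hm'
  set a := Real.log ηs / ηs with ha
  have hau : a < Real.log ηs / m := by
    rw [ha, div_lt_div_iff₀ hηs (by linarith)]
    nlinarith
  have huv : Real.log ηs / m < Real.log c := by
    rw [hlogc]
    exact div_lt_div_of_pos_right hℓs (by linarith)
  obtain ⟨κ, hκ, htan⟩ := exists_mul_sq_le_hfun hau huv hv
    (tangentGap_eq_zero_of_etaEq hηs hEq).ge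
  rw [Real.exp_log hc0] at htan
  set x₀ := Real.exp a with hx₀
  have hx₀0 : 0 < x₀ := Real.exp_pos a
  have hx₀1 : x₀ < 1 := Real.exp_lt_one_iff.2 (by linarith)
  have hlogx : Real.log x₀ = a := Real.log_exp a
  set b := -a - -Real.log η / η with hb
  have hb0 : 0 < b := by
    have : a < Real.log η / η := by
      rw [ha, div_lt_div_iff₀ hηs hη0]
      nlinarith
    rw [hb, neg_div]
    linarith
  set t := min (1 - x₀) (b / 4 / (1 / x₀ + 1 / η / η)) with ht
  have ht0 : 0 < t := lt_min (by linarith) (by positivity)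
  have ht1 : x₀ + t ≤ 1 := by linarith [min_le_left (1 - x₀) (b / 4 / (1 / x₀ + 1 / η / η))]
  have ht2 : t / x₀ + t / η / η ≤ b / 4 := by
    have h1 : t ≤ b / 4 / (1 / x₀ + 1 / η / η) := min_le_right _ _
    rw [le_div_iff₀ (by positivity)] at h1
    calc t / x₀ + t / η / η = t * (1 / x₀ + 1 / η / η) := by ring
      _ ≤ b / 4 := h1
  set P := 2 / (t * b) with hP
  have hP0 : 0 < P := by positivity
  refine ⟨2 * ((1 + L * c * (P / η)) / κ + P), by positivity, b / 4 * η * L, by positivity, ?_⟩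
  intro E ι _ _ _ _ _ A d hcard hdeg Φ δ hδ0 hδ₀ hΦ q hq hqη hδ
  have hM0 : (0 : ℝ) < Fintype.card E := by exact_mod_cast Fintype.card_pos
  have h1 := card_small_le hcard hdeg hη0 hc0 hc1 hcη hx₀0 ht0 ht1 hΦ hq hqη hδ
  rw [← hL, hlogx] at h1
  set s : ℝ := ((Finset.univ.filter fun e => q e < x₀).card : ℝ) with hs
  have hs0 : 0 ≤ s := Nat.cast_nonneg _
  have h2 : b / 2 ≤ -a - t / x₀ - (δ / L + L + t / η) / η := by
    have h3 : δ / L / η ≤ b / 4 := by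
      rw [div_div, div_le_iff₀ (by positivity)]
      linarith
    have h4 : L / η ≤ -Real.log η / η := div_le_div_of_nonneg_right hLℓ hη0.le
    have h5 : (δ / L + L + t / η) / η = δ / L / η + L / η + t / η / η := by ring
    rw [h5]
    linarith
  set σ := s / Fintype.card E with hσ
  have hσP : σ ≤ P * δ := by
    have h3 : s * (t * (b / 2)) ≤ δ * Fintype.card E :=
      le_trans (by gcongr) h1
    rw [hσ, hP, div_le_iff₀ hM0, div_mul_eq_mul_div, div_mul_eq_mul_div,
      le_div_iff₀ (by positivity)]
    linarith
  refine (sum_sq_sub_le hm hcard hdeg hη0 hc0 hc1 hcη hx₀0 hx₀1.le hκ htan hΦ hq hqη hδ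
    (σ := σ) (by rw [hσ, div_mul_cancel₀ _ hM0.ne'])).trans ?_
  rw [← hL]
  refine mul_le_mul_of_nonneg_right ?_ hM0.le
  calc 2 * ((δ + L * c * (σ / η)) / κ + σ)
      ≤ 2 * ((δ + L * c * (P * δ / η)) / κ + P * δ) := by gcongr
    _ = 2 * ((1 + L * c * (P / η)) / κ + P) * δ := by ring

section Copies

open SimpleGraph

variable {k n : ℕ} {H : SimpleGraph (Fin k)}

/-- The copies of `H` in the complete graph on `Fin n`. -/
abbrev Copies (H : SimpleGraph (Fin k)) (n : ℕ) : Type :=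
  {K : (⊤ : SimpleGraph (Fin n)).Subgraph // Nonempty (H ≃g K.coe)}

instance : Fintype (Copies H n) := Fintype.ofFinite _

/-- The edges of a copy of `H`. -/
def Copies.edges (K : Copies H n) : Finset (Edge n) :=
  Finset.univ.filter fun e => (e : Sym2 (Fin n)) ∈ K.1.edgeSet

lemma Copies.mem_edges {K : Copies H n} {e : Edge n} :
    e ∈ K.edges ↔ (e : Sym2 (Fin n)) ∈ K.1.edgeSet := by
  simp [Copies.edges]

lemma NHKn_eq_card : NHKn H n = Fintype.card (Copies H n) := by
  rw [NHKn, countCopies, ← Nat.card_coe_set_eq, ← Nat.card_eq_fintype_card]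
  rfl

/-- Copies of `H` in a graph are the copies in the complete graph all of whose edges are present. -/
def copiesEquiv (H : SimpleGraph (Fin k)) (G : EGraph n) :
    {K : (toSG G).Subgraph | Nonempty (H ≃g K.coe)} ≃
      {K : Copies H n // ∀ e ∈ K.edges, G e = true} where
  toFun K := ⟨⟨⟨K.1.verts, K.1.Adj, fun h => (K.1.adj_sub h).ne, K.1.edge_vert, K.1.symm⟩, K.2⟩, by
    rintro ⟨e, he⟩ hK
    rw [Copies.mem_edges] at hK
    induction e with
    | _ u v =>
      have h1 : K.1.Adj u v := hK
      have h2 := K.1.adj_sub h1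
      rw [toSG, SimpleGraph.fromEdgeSet_adj] at h2
      exact h2.1.2⟩
  invFun K := ⟨⟨K.1.1.verts, K.1.1.Adj, fun {u v} h => by
    have hne : u ≠ v := (K.1.1.adj_sub h).ne
    have hd : ¬ s(u, v).IsDiag := by simpa using hne
    rw [toSG, SimpleGraph.fromEdgeSet_adj]
    exact ⟨⟨hd, K.2 ⟨s(u, v), hd⟩ (Copies.mem_edges.2 h)⟩, hne⟩,
    K.1.1.edge_vert, K.1.1.symm⟩, K.1.2⟩
  left_inv _ := rfl
  right_inv _ := rfl

lemma NH_eq_sum (G : EGraph n) :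
    NH H G = ∑ K : Copies H n, ∏ e ∈ K.edges, if G e then (1 : ℝ) else 0 := by
  rw [NH, countCopies, ← Nat.card_coe_set_eq, Nat.card_congr (copiesEquiv H G),
    Nat.card_eq_fintype_card, Fintype.card_subtype, Finset.card_filter]
  push_cast
  refine Finset.sum_congr rfl fun K _ => ?_
  rw [Finset.prod_ite_zero]
  simp

lemma sum_wt_mul_prod (q : Edge n → ℝ) (A : Finset (Edge n)) :
    ∑ G : EGraph n, wt q G * ∏ e ∈ A, (if G e then (1 : ℝ) else 0) = ∏ e ∈ A, q e := by
  have h1 : ∀ G : EGraph n, wt q G * ∏ e ∈ A, (if G e then (1 : ℝ) else 0) =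
      ∏ e, (if G e then q e else 1 - q e) * if e ∈ A then (if G e then (1 : ℝ) else 0) else 1 :=
    fun G => by rw [wt, Finset.prod_mul_distrib, Finset.prod_ite_mem, Finset.univ_inter]
  have h2 : ∏ e ∈ A, q e = ∏ e : Edge n, ∑ b : Bool, (if b then q e else 1 - q e) *
      if e ∈ A then (if b then (1 : ℝ) else 0) else 1 := by
    rw [← Finset.univ_inter A, ← Finset.prod_ite_mem]
    refine Finset.prod_congr rfl fun e _ => ?_
    by_cases he : e ∈ A <;> simp [he]
  rw [h2, Finset.prod_univ_sum, Fintype.piFinset_univ]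
  exact Finset.sum_congr rfl fun G _ => h1 G

lemma expNH_eq_sum (q : Edge n → ℝ) :
    expNH H q = ∑ K : Copies H n, ∏ e ∈ K.edges, q e := by
  simp_rw [expNH, NH_eq_sum, Finset.mul_sum]
  rw [Finset.sum_comm]
  exact Finset.sum_congr rfl fun K _ => sum_wt_mul_prod q K.edges

lemma Copies.card_edges (K : Copies H n) : K.edges.card = H.edgeSet.ncard := by
  obtain ⟨φ⟩ := K.2
  have h1 : K.1.edgeSet.ncard = H.edgeSet.ncard := by
    rw [← Subgraph.image_coe_edgeSet_coe,
      Set.ncard_image_of_injective _ (Sym2.map.injective Subtype.val_injective),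
      ← Nat.card_coe_set_eq, ← Nat.card_coe_set_eq]
    exact (Nat.card_congr φ.mapEdgeSet).symm
  rw [← h1, ← Set.ncard_coe_finset, ← Set.ncard_image_of_injective _ Subtype.val_injective]
  congr 1
  ext e
  simp only [Set.mem_image, Finset.mem_coe, Copies.mem_edges]
  refine ⟨fun ⟨e', h, he⟩ => he ▸ h, fun h => ⟨⟨e, ?_⟩, h, rfl⟩⟩
  exact SimpleGraph.not_isDiag_of_mem_edgeSet _ (K.1.edgeSet_subset h)

/-- The image of a copy of `H` under a permutation of the vertices. -/
def Copies.perm (σ : Equiv.Perm (Fin n)) (K : Copies H n) : Copies H n :=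
  ⟨K.1.map (Iso.completeGraph σ).toHom,
    K.2.map fun φ => ((Iso.completeGraph σ).toCopy.isoSubgraphMap K.1).comp φ⟩

lemma Copies.perm_injective (σ : Equiv.Perm (Fin n)) :
    Function.Injective (Copies.perm σ : Copies H n → Copies H n) := by
  refine Function.LeftInverse.injective (g := Copies.perm σ⁻¹) fun K => Subtype.ext ?_
  simp only [Copies.perm, ← Subgraph.map_comp]
  convert K.1.map_id
  ext x
  simp [Iso.completeGraph]

lemma Copies.map_mem_edgeSet_perm (σ : Equiv.Perm (Fin n)) {K : Copies H n} {e : Sym2 (Fin n)}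
    (he : e ∈ K.1.edgeSet) : e.map σ ∈ (K.perm σ).1.edgeSet := by
  rw [Copies.perm, Subgraph.edgeSet_map]
  exact ⟨e, he, rfl⟩

lemma exists_perm_map_eq (e e' : Edge n) :
    ∃ σ : Equiv.Perm (Fin n), (e : Sym2 (Fin n)).map σ = e' := by
  obtain ⟨e, he⟩ := e
  obtain ⟨e', he'⟩ := e'
  induction e with
  | _ a b =>
  induction e' with
  | _ a' b' =>
  simp only [Sym2.mk_isDiag_iff] at he he'
  refine ⟨(Equiv.swap a a').trans (Equiv.swap (Equiv.swap a a' b) b'), ?_⟩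
  have h1 : a' ≠ Equiv.swap a a' b := fun h => he <|
    (Equiv.swap a a').injective ((Equiv.swap_apply_left a a').trans h)
  simp [Equiv.swap_apply_of_ne_of_ne h1 he']

lemma card_copies_mem_edges (e e' : Edge n) :
    (Finset.univ.filter fun K : Copies H n => e ∈ K.edges).card =
      (Finset.univ.filter fun K : Copies H n => e' ∈ K.edges).card := by
  have h : ∀ e e' : Edge n, (Finset.univ.filter fun K : Copies H n => e ∈ K.edges).card ≤
      (Finset.univ.filter fun K : Copies H n => e' ∈ K.edges).card := by
    intro e e'
    obtain ⟨σ, hσ⟩ := exists_perm_map_eq e e'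
    refine Finset.card_le_card_of_injOn (Copies.perm σ) (fun K hK => ?_)
      (Copies.perm_injective σ).injOn
    simp only [Finset.coe_filter, Finset.mem_univ, true_and, Set.mem_ofPred_eq,
      Copies.mem_edges] at hK ⊢
    exact hσ ▸ Copies.map_mem_edgeSet_perm σ hK
  exact (h e e').antisymm (h e' e)

lemma nonempty_copies (h : k ≤ n) : Nonempty (Copies H n) := by
  let f : Copy H (⊤ : SimpleGraph (Fin n)) :=
    ⟨⟨Fin.castLE h, fun hab => (Fin.castLE_injective h).ne hab.ne⟩, Fin.castLE_injective h⟩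
  exact ⟨⟨f.toSubgraph, ⟨f.isoToSubgraph⟩⟩⟩

lemma card_edge : Fintype.card (Edge n) = n.choose 2 := by
  have := Sym2.card_subtype_not_diag (α := Fin n)
  rw [Fintype.card_fin] at this
  rw [← this]

end Copies

section CutNorm

variable {n : ℕ}

lemma sum_sq_devMat_le (q : Edge n → ℝ) (c : ℝ) :
    ∑ p : Fin n × Fin n, devMat q c p.1 p.2 ^ 2 ≤ 2 * ∑ e, (q e - c) ^ 2 := by
  set F : Sym2 (Fin n) → ℝ := fun e => if h : e.IsDiag then 0 else (q ⟨e, h⟩ - c) ^ 2 with hF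
  have h1 : ∀ p : Fin n × Fin n, devMat q c p.1 p.2 ^ 2 = F s(p.1, p.2) := by
    rintro ⟨i, j⟩
    by_cases hij : i = j <;> simp [devMat, hF, hij]
  have hF0 : ∀ e, 0 ≤ F e := fun e => by
    simp only [hF]; split_ifs <;> positivity
  have hcard : ∀ e : Sym2 (Fin n),
      (Finset.univ.filter fun p : Fin n × Fin n => s(p.1, p.2) = e).card ≤ 2 := by
    intro e
    induction e with
    | _ a b =>
    refine (Finset.card_le_card (t := {(a, b), (b, a)}) fun p hp => ?_).trans Finset.card_le_two
    simpa [Prod.ext_iff] using hp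
  have h2 : ∑ e, F e = ∑ e : Edge n, (q e - c) ^ 2 := by
    have h3 : ∀ e : Edge n, (q e - c) ^ 2 = F e := fun e => by simp [hF, e.2]
    simp_rw [h3]
    rw [← Finset.sum_subtype (Finset.univ.filter fun e : Sym2 (Fin n) => ¬ e.IsDiag)
      (fun e => by simp) F, Finset.sum_filter]
    refine Finset.sum_congr rfl fun e _ => ?_
    by_cases he : e.IsDiag <;> simp [hF, he]
  rw [← h2, Finset.mul_sum, ← Finset.sum_fiberwise (s := Finset.univ)
    (g := fun p : Fin n × Fin n => s(p.1, p.2))]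
  refine Finset.sum_le_sum fun e _ => ?_
  calc ∑ p with s(p.1, p.2) = e, devMat q c p.1 p.2 ^ 2
      = ∑ p : Fin n × Fin n with s(p.1, p.2) = e, F e :=
        Finset.sum_congr rfl fun p hp => by rw [h1, (Finset.mem_filter.1 hp).2]
    _ ≤ 2 * F e := by
        rw [Finset.sum_const, nsmul_eq_mul]
        exact mul_le_mul_of_nonneg_right (by exact_mod_cast hcard e) (hF0 e)

lemma cutNorm_le_of_sum_sq_le (hn : 0 < n) {M : Matrix (Fin n) (Fin n) ℝ} {B : ℝ} (hB : 0 ≤ B)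
    (h : ∑ p : Fin n × Fin n, M p.1 p.2 ^ 2 ≤ B ^ 2 * n ^ 2) : cutNorm M ≤ B := by
  have hn' : (0 : ℝ) < n := by exact_mod_cast hn
  refine csSup_le ⟨_, 0, 0, by simp, by simp, rfl⟩ ?_
  rintro x ⟨a, b, ha, hb, rfl⟩
  rw [div_le_iff₀ (by positivity)]
  have h1 : |∑ i, ∑ j, a i * M i j * b j| ≤ ∑ p : Fin n × Fin n, |M p.1 p.2| := by
    rw [← Fintype.sum_prod_type' (f := fun i j => a i * M i j * b j)]
    refine (Finset.abs_sum_le_sum_abs _ _).trans (Finset.sum_le_sum fun p _ => ?_)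
    rw [abs_mul, abs_mul, abs_of_nonneg (ha _).1, abs_of_nonneg (hb _).1]
    have h3 := abs_nonneg (M p.1 p.2)
    calc a p.1 * |M p.1 p.2| * b p.2 ≤ 1 * |M p.1 p.2| * 1 := by
          gcongr
          · exact (hb _).1
          · exact (ha _).2
          · exact (hb _).2
      _ = _ := by ring
  have h2 := sq_sum_le_card_mul_sum_sq (s := (Finset.univ : Finset (Fin n × Fin n)))
    (f := fun p => |M p.1 p.2|)
  simp only [sq_abs, Finset.card_univ, Fintype.card_prod, Fintype.card_fin] at h2
  push_cast at h2
  refine h1.trans (abs_le_of_sq_le_sq' ?_ (by positivity)).2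
  calc (∑ p : Fin n × Fin n, |M p.1 p.2|) ^ 2
      ≤ n * n * ∑ p : Fin n × Fin n, M p.1 p.2 ^ 2 := h2
    _ ≤ n * n * (B ^ 2 * n ^ 2) := by gcongr
    _ = (B * n ^ 2) ^ 2 := by ring

end CutNorm

/-- stability of the variational problem, Proposition in the paper. -/
theorem statement9 {k : ℕ} (H : SimpleGraph (Fin k)) (hH : H.edgeSet.Nonempty)
    (ηstar η : ℝ) (hηstar : ηstar ∈ Set.Ioo (0:ℝ) 1) (hEq : etaEq (eH H) ηstar)
    (hη : η ∈ Set.Ioo ηstar 1) :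
    ∃ C ε0 : ℝ, 0 < C ∧ 0 < ε0 ∧ ∀ ε : ℝ, ε ∈ Set.Ioo (0:ℝ) ε0 → ∀ n : ℕ, k ≤ n →
      ∀ q : Edge n → ℝ, (∀ e, q e ∈ Set.Icc (0:ℝ) 1) → expNH H q ≤ η * NHKn H n →
        (∀ q' : Edge n → ℝ, (∀ e, q' e ∈ Set.Icc (0:ℝ) 1) → expNH H q' ≤ η * NHKn H n →
          q' ≠ (fun _ => η ^ (1 / eH H)) → Phi H n η < ∑ e : Edge n, hfun (q' e)) ∧
        ((∑ e : Edge n, hfun (q e)) < Phi H n η + ε ^ 12 * (n.choose 2 : ℝ) →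
          cutNorm (devMat q (η ^ (1 / eH H))) < C * ε) := by
  have hm : 0 < H.edgeSet.ncard := (Set.ncard_pos (Set.toFinite _)).2 hH
  obtain ⟨K, hK, δ₀, hδ₀, hstab⟩ := exists_sum_sq_sub_le hm hηstar.1 hη.1 hη.2 hEq
  have hk : 2 ≤ k := by
    obtain ⟨e, he⟩ := hH
    induction e with
    | _ a b =>
    have : a ≠ b := (H.mem_edgeSet.1 he).ne
    by_contra! h
    exact this (Fin.ext (by omega))
  refine ⟨Real.sqrt K + 1, min 1 δ₀, by positivity, lt_min one_pos hδ₀, ?_⟩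
  intro ε hε n hn q hq hqη
  have hε0 := hε.1
  have hε1 : ε < 1 := hε.2.trans_le (min_le_left _ _)
  have hM : 0 < Fintype.card (Edge n) := by
    rw [card_edge]
    exact Nat.choose_pos (hk.trans hn)
  have : Nonempty (Edge n) := Fintype.card_pos_iff.1 hM
  have : Nonempty (Copies H n) := nonempty_copies hn
  obtain ⟨e₀⟩ := ‹Nonempty (Edge n)›
  have hΦ : ∀ q : Edge n → ℝ, (∀ e, q e ∈ Set.Icc (0 : ℝ) 1) →
      ∑ K : Copies H n, ∏ e ∈ K.edges, q e ≤ η * Fintype.card (Copies H n) →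
      Phi H n η ≤ ∑ e, hfun (q e) := by
    intro q hq hqη
    refine csInf_le ⟨0, ?_⟩ ⟨q, hq, by rwa [expNH_eq_sum, NHKn_eq_card], rfl⟩
    rintro x ⟨q', hq', -, rfl⟩
    exact Finset.sum_nonneg fun e _ => hfun_nonneg (hq' e).1
  have hdist : ∀ {δ : ℝ}, 0 ≤ δ → δ ≤ δ₀ → ∀ q : Edge n → ℝ, (∀ e, q e ∈ Set.Icc (0 : ℝ) 1) →
      expNH H q ≤ η * NHKn H n → ∑ e, hfun (q e) ≤ Phi H n η + δ * n.choose 2 →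
      ∑ e, (q e - η ^ (1 / eH H)) ^ 2 ≤ K * δ * n.choose 2 := by
    intro δ hδ0 hδ1 q hq hqη hsum
    rw [expNH_eq_sum, NHKn_eq_card] at hqη
    rw [← card_edge] at hsum ⊢
    exact hstab Copies.card_edges (fun e => card_copies_mem_edges e e₀) hδ0 hδ1 hΦ q hq hqη hsum
  refine ⟨fun q' hq' hq'η hne => ?_, fun hsum => ?_⟩
  · by_contra! h
    have h1 := hdist le_rfl hδ₀.le q' hq' hq'η (by linarith)
    rw [mul_zero, zero_mul] at h1
    refine hne (funext fun e => ?_)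
    have h2 := (Finset.sum_eq_zero_iff_of_nonneg fun e _ => sq_nonneg _).1
      (h1.antisymm (Finset.sum_nonneg fun e _ => sq_nonneg _)) e (Finset.mem_univ e)
    exact sub_eq_zero.1 (pow_eq_zero_iff two_ne_zero |>.1 h2)
  · have hδ : ε ^ 12 ≤ δ₀ := (pow_le_of_le_one hε0.le hε1.le (by norm_num)).trans
      (hε.2.le.trans (min_le_right _ _))
    have h1 := hdist (by positivity) hδ q hq hqη hsum.le
    have h2 := sum_sq_devMat_le q (η ^ (1 / eH H))
    have hn0 : 0 < n := by omega
    have h3 : 2 * (n.choose 2 : ℝ) ≤ n ^ 2 := by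
      rw [Nat.cast_choose_two]
      nlinarith [(Nat.cast_nonneg n : (0 : ℝ) ≤ n)]
    have h4 : cutNorm (devMat q (η ^ (1 / eH H))) ≤ Real.sqrt K * ε ^ 6 := by
      refine cutNorm_le_of_sum_sq_le hn0 (by positivity) ?_
      rw [mul_pow, Real.sq_sqrt hK.le]
      calc _ ≤ 2 * (K * ε ^ 12 * n.choose 2) := by linarith
        _ = K * ε ^ 12 * (2 * n.choose 2) := by ring
        _ ≤ K * ε ^ 12 * n ^ 2 := by gcongr
        _ = _ := by ring
    have h5 : ε ^ 6 ≤ ε := pow_le_of_le_one hε0.le hε1.le (by norm_num)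
    calc _ ≤ Real.sqrt K * ε ^ 6 := h4
      _ ≤ Real.sqrt K * ε := by gcongr
      _ < (Real.sqrt K + 1) * ε := by linarith

end LowerTails
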